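/- arXiv:1904.13330 — 3 statements merged into one kernel-verified Lean document; each statement's English description precedes it below -/
import Mathlib

section
/- Assume 0 < q < 1/2. For every integer k ≥ 1, conditionally on X_1 = X_2 = +1, the probability that the attack cycle ends with exactly k consecutive blocks H — that is, X_{τ−k+1} = ⋯ = X_τ = −1 and X_{τ−k} = +1 — equals p q^{k−1}. -/
open MeasureTheory ProbabilityTheory Filter Finset

/-- Partial sums of the walk: `walkS X n ω = X 1 ω + ⋯ + X n ω` (so `walkS X 0 ω = 0`). -/
noncomputable def walkS {Ω : Type*} (X : ℕ → Ω → ℤ) (n : ℕ) (ω : Ω) : ℤ :=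
  ∑ i ∈ Finset.Icc 1 n, X i ω

/-- The stopping time `τ = inf {n ≥ 3 : S_n = 1}` (`sInf ∅ = 0` by convention). -/
noncomputable def cycleTau {Ω : Type*} (X : ℕ → Ω → ℤ) (ω : Ω) : ℕ :=
  sInf {n : ℕ | 3 ≤ n ∧ walkS X n ω = 1}

namespace SM

lemma walkS_succ {Ω : Type*} (X : ℕ → Ω → ℤ) (n : ℕ) (ω : Ω) :
    walkS X (n + 1) ω = walkS X n ω + X (n + 1) ω := by
  unfold walkS
  rw [Finset.sum_Icc_succ_top (by omega)]

lemma walkS_zero {Ω : Type*} (X : ℕ → Ω → ℤ) (ω : Ω) : walkS X 0 ω = 0 := by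
  simp [walkS]

lemma walkS_congr {Ω : Type*} (X : ℕ → Ω → ℤ) (n : ℕ) (ω ω' : Ω)
    (h : ∀ i ≤ n, X i ω = X i ω') (m : ℕ) (hm : m ≤ n) : walkS X m ω = walkS X m ω' := by
  unfold walkS
  apply Finset.sum_congr rfl
  intro i hi
  rw [Finset.mem_Icc] at hi
  exact h i (by omega)

/-- `B` depends only on coordinates `≤ n`. -/
def Dep {Ω : Type*} (X : ℕ → Ω → ℤ) (n : ℕ) (B : Set Ω) : Prop :=
  ∀ ω ω', (∀ i ≤ n, X i ω = X i ω') → ω ∈ B → ω' ∈ B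

lemma Dep.eq_preimage {Ω : Type*} {X : ℕ → Ω → ℤ} {n : ℕ} {B : Set Ω} (h : Dep X n B) :
    B = (fun ω (i : Finset.Iic n) => X i ω) ⁻¹' (Set.image (fun ω (i : Finset.Iic n) => X i ω) B) := by
  apply Set.Subset.antisymm (Set.subset_preimage_image _ _)
  rintro ω' ⟨ω, hω, he⟩
  refine h ω ω' (fun i hi => ?_) hω
  exact congrFun he ⟨i, by simpa using hi⟩

lemma Dep.measurableSet {Ω : Type*} [MeasurableSpace Ω] {X : ℕ → Ω → ℤ} {n : ℕ} {B : Set Ω}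
    (h : Dep X n B) (hmeas : ∀ i, Measurable (X i)) : MeasurableSet B := by
  rw [h.eq_preimage]
  apply measurableSet_preimage
  · exact measurable_pi_lambda _ (fun i => hmeas i)
  · exact (Set.to_countable _).measurableSet

lemma Dep.indep {Ω : Type*} [MeasurableSpace Ω] {μ : Measure Ω} [IsProbabilityMeasure μ]
    {X : ℕ → Ω → ℤ} {n : ℕ} {B : Set Ω}
    (h : Dep X n B) (hmeas : ∀ i, Measurable (X i)) (hindep : iIndepFun X μ) (a : ℤ) :
    μ (B ∩ {ω | X (n + 1) ω = a}) = μ B * μ {ω | X (n + 1) ω = a} := by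
  have hI := hindep.indepFun_finset (Finset.Iic n) {n + 1} (by simp) hmeas
  have h2 : {ω | X (n + 1) ω = a} =
      (fun ω (i : ({n + 1} : Finset ℕ)) => X i ω) ⁻¹' {f | f ⟨n + 1, by simp⟩ = a} := by
    ext ω; simp
  rw [h2, h.eq_preimage]
  exact hI.measure_inter_preimage_eq_mul _ _ (Set.to_countable _).measurableSet
    (Set.to_countable _).measurableSet

/-- The walk is at `y` at time `n+1`, with `X 1 = 1` and it stayed `≥ 2` on `[2, n+1]`. -/
def D {Ω : Type*} (X : ℕ → Ω → ℤ) (n : ℕ) (y : ℤ) : Set Ω :=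
  {ω | X 1 ω = 1 ∧ (∀ m, 2 ≤ m → m ≤ n + 1 → 2 ≤ walkS X m ω) ∧ walkS X (n + 1) ω = y}

/-- `D` followed by `j` down steps. -/
def Dr {Ω : Type*} (X : ℕ → Ω → ℤ) (n : ℕ) (y : ℤ) (j : ℕ) : Set Ω :=
  {ω | ω ∈ D X n y ∧ ∀ i, i < j → X (n + 2 + i) ω = -1}

lemma D_dep {Ω : Type*} (X : ℕ → Ω → ℤ) (n : ℕ) (y : ℤ) : Dep X (n + 1) (D X n y) := by
  rintro ω ω' h ⟨h1, h2, h3⟩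
  have hw := walkS_congr X (n + 1) ω ω' h
  refine ⟨by rw [← h 1 (by omega)]; exact h1, fun m hm hm' => ?_, ?_⟩
  · rw [← hw m hm']; exact h2 m hm hm'
  · rw [← hw _ le_rfl]; exact h3

lemma Dr_dep {Ω : Type*} (X : ℕ → Ω → ℤ) (n : ℕ) (y : ℤ) (j : ℕ) :
    Dep X (n + 1 + j) (Dr X n y j) := by
  rintro ω ω' h ⟨h1, h2⟩
  refine ⟨D_dep X n y ω ω' (fun i hi => h i (by omega)) h1, fun i hi => ?_⟩
  rw [← h _ (by omega)]; exact h2 i hi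

lemma Dr_succ {Ω : Type*} (X : ℕ → Ω → ℤ) (n : ℕ) (y : ℤ) (j : ℕ) :
    Dr X n y (j + 1) = Dr X n y j ∩ {ω | X (n + 1 + j + 1) ω = -1} := by
  have e : n + 1 + j + 1 = n + 2 + j := by omega
  ext ω
  simp only [Dr, Set.mem_inter_iff, Set.mem_ofPred_eq, e, and_assoc]
  refine and_congr_right fun _ => ⟨fun h => ⟨fun i hi => h i (by omega), h j (by omega)⟩, ?_⟩
  rintro ⟨h, h'⟩ i hi
  rcases Nat.lt_succ_iff_lt_or_eq.1 hi with hi | rfl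
  · exact h i hi
  · exact h'

section meas
variable {Ω : Type*} [MeasurableSpace Ω] {μ : Measure Ω} [IsProbabilityMeasure μ]
  {X : ℕ → Ω → ℤ}

lemma measure_Dr (hmeas : ∀ i, Measurable (X i)) (hindep : iIndepFun X μ) {P : ENNReal}
    (hdown : ∀ i, μ {ω | X i ω = -1} = P) (n : ℕ) (y : ℤ) (j : ℕ) :
    μ (Dr X n y j) = μ (D X n y) * P ^ j := by
  induction j with
  | zero => simp [Dr]
  | succ j ih =>
    rw [Dr_succ, (Dr_dep X n y j).indep hmeas hindep, ih, hdown, pow_succ, mul_assoc]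

lemma D_step (hmeas : ∀ i, Measurable (X i)) (hindep : iIndepFun X μ) {P Q : ENNReal}
    (hup : ∀ i, μ {ω | X i ω = 1} = Q)
    (hdown : ∀ i, μ {ω | X i ω = -1} = P)
    (hpm : ∀ᵐ ω ∂μ, ∀ i, X i ω = 1 ∨ X i ω = -1) (n : ℕ) (y : ℤ) (hy : 2 ≤ y) :
    μ (D X (n + 1) y) = μ (D X n (y - 1)) * Q + μ (D X n (y + 1)) * P := by
  rw [← hup (n + 1 + 1), ← hdown (n + 1 + 1), ← (D_dep X n _).indep hmeas hindep,
    ← (D_dep X n _).indep hmeas hindep, ← measure_union]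
  · apply measure_congr
    filter_upwards [hpm] with ω hω
    apply propext
    change (ω ∈ D X (n + 1) y) ↔ (ω ∈ (D X n (y - 1) ∩ {ω | X (n + 1 + 1) ω = 1}) ∪
      (D X n (y + 1) ∩ {ω | X (n + 1 + 1) ω = -1}))
    simp only [D, Set.mem_union, Set.mem_inter_iff, Set.mem_ofPred_eq]
    have hs := walkS_succ X (n + 1) ω
    constructor
    · rintro ⟨h1, h2, h3⟩
      rcases hω (n + 1 + 1) with h | h
      · exact Or.inl ⟨⟨h1, fun m hm hm' => h2 m hm (by omega), by omega⟩, h⟩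
      · exact Or.inr ⟨⟨h1, fun m hm hm' => h2 m hm (by omega), by omega⟩, h⟩
    · rintro (⟨⟨h1, h2, h3⟩, h⟩ | ⟨⟨h1, h2, h3⟩, h⟩)
      all_goals
        refine ⟨h1, fun m hm hm' => ?_, by omega⟩
        rcases Nat.lt_or_ge (n + 1) m with h' | h'
        · obtain rfl : m = n + 1 + 1 := by omega
          omega
        · exact h2 m hm h'
  · rw [Set.disjoint_left]
    rintro ω ⟨_, h⟩ ⟨_, h'⟩
    simp only [Set.mem_ofPred_eq] at h h'
    omega
  · exact (D_dep X n _).measurableSet hmeas |>.inter (hmeas _ (measurableSet_singleton (-1)))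

lemma D_zero_one : D X 0 1 = {ω | X 1 ω = 1} := by
  ext ω
  have h := walkS_succ X 0 ω
  rw [walkS_zero] at h
  simp only [D, Set.mem_ofPred_eq]
  constructor
  · exact fun h => h.1
  · intro h1
    refine ⟨h1, fun m hm hm' => by omega, ?_⟩
    simp at h
    simp [h, h1]

lemma D_zero_of_two_le (y : ℤ) (hy : 2 ≤ y) : D X 0 y = ∅ := by
  ext ω
  have h := walkS_succ X 0 ω
  rw [walkS_zero] at h
  simp only [D, Set.mem_ofPred_eq, Set.mem_empty_iff_false, iff_false]
  rintro ⟨h1, -, h3⟩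
  simp at h h3
  omega

lemma D_succ_one (n : ℕ) : D X (n + 1) 1 = ∅ := by
  ext ω
  simp only [D, Set.mem_ofPred_eq, Set.mem_empty_iff_false, iff_false]
  rintro ⟨h1, h2, h3⟩
  have := h2 (n + 1 + 1) (by omega) le_rfl
  omega

lemma hpm_of (hmeas : ∀ i, Measurable (X i)) {q p : ℝ} (hq : 0 < q) (hp0 : 0 < p)
    (hp : p = 1 - q)
    (hup : ∀ i, μ {ω | X i ω = 1} = ENNReal.ofReal q)
    (hdown : ∀ i, μ {ω | X i ω = -1} = ENNReal.ofReal p) :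
    ∀ᵐ ω ∂μ, ∀ i, X i ω = 1 ∨ X i ω = -1 := by
  rw [ae_all_iff]
  intro i
  have hm1 : MeasurableSet {ω | X i ω = 1} := hmeas i (measurableSet_singleton 1)
  have hm2 : MeasurableSet {ω | X i ω = -1} := hmeas i (measurableSet_singleton (-1))
  have : μ ({ω | X i ω = 1} ∪ {ω | X i ω = -1}) = 1 := by
    rw [measure_union _ hm2, hup, hdown, ← ENNReal.ofReal_add hq.le hp0.le, hp]
    · simp
    · rw [Set.disjoint_left]
      intro ω h h'
      simp only [Set.mem_ofPred_eq] at h h'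
      omega
  have h2 := (prob_compl_eq_zero_iff (hm1.union hm2)).2 this
  exact h2

lemma tau_fin (hmeas : ∀ i, Measurable (X i)) (hindep : iIndepFun X μ)
    {q p : ℝ} (hq : 0 < q) (hq1 : q < 1 / 2) (hp : p = 1 - q)
    (hup : ∀ i, μ {ω | X i ω = 1} = ENNReal.ofReal q)
    (hdown : ∀ i, μ {ω | X i ω = -1} = ENNReal.ofReal p) :
    ∀ᵐ ω ∂μ, ∃ n, 3 ≤ n ∧ walkS X n ω < 1 := by
  have hp0 : 0 < p := by linarith
  have hpm := hpm_of hmeas hq hp0 hp hup hdown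
  have hpm' := ae_all_iff.1 hpm
  let Y : ℕ → Ω → ℝ := fun i ω => (X (i + 1) ω : ℝ)
  have hYm : ∀ i, Measurable (Y i) := fun i => measurable_from_top.comp (hmeas _)
  have hint : Integrable (Y 0) μ := by
    refine Integrable.of_bound (hYm 0).aestronglyMeasurable 1 ?_
    filter_upwards [hpm' 1] with ω h
    rcases h with h | h <;> simp [Y, h]
  have hYi : Pairwise (Function.onFun (fun f g => IndepFun f g μ) Y) := by
    intro i j hij
    have := hindep.indepFun (i := i + 1) (j := j + 1) (by omega)
    exact this.comp (φ := fun z : ℤ => (z : ℝ)) (ψ := fun z : ℤ => (z : ℝ))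
      measurable_from_top measurable_from_top
  have hid : ∀ i, IdentDistrib (Y i) (Y 0) μ μ := by
    intro i
    have : IdentDistrib (X (i + 1)) (X 1) μ μ := by
      refine ⟨(hmeas _).aemeasurable, (hmeas _).aemeasurable, ?_⟩
      refine Measure.ext_of_singleton fun z => ?_
      rw [Measure.map_apply (hmeas _) (measurableSet_singleton z),
        Measure.map_apply (hmeas _) (measurableSet_singleton z)]
      by_cases h1 : z = 1
      · subst h1; exact (hup _).trans (hup _).symm
      by_cases h2 : z = -1
      · subst h2; exact (hdown _).trans (hdown _).symm
      have key : ∀ j, μ (X j ⁻¹' {z}) = 0 := by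
        intro j
        have hne : ∀ᵐ ω ∂μ, X j ω ≠ z := by
          filter_upwards [hpm' j] with ω h
          rcases h with h | h <;> rw [h]
          · exact Ne.symm h1
          · exact Ne.symm h2
        have h3 := ae_iff.1 hne
        simp only [ne_eq, not_not] at h3
        exact h3
      rw [key, key]
    exact this.comp (u := fun z : ℤ => (z : ℝ)) measurable_from_top
  have hmean : ∫ ω, Y 0 ω ∂μ = q - p := by
    have hm1 : MeasurableSet {ω | X 1 ω = 1} := hmeas 1 (measurableSet_singleton 1)
    have : Y 0 =ᵐ[μ] fun ω => 2 * ({ω | X 1 ω = 1}.indicator (fun _ => (1 : ℝ)) ω) - 1 := by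
      filter_upwards [hpm' 1] with ω h
      rcases h with h | h <;> simp [Y, h, Set.indicator] <;> norm_num
    rw [integral_congr_ae this, integral_sub, integral_const_mul, integral_indicator_const _ hm1]
    · simp only [measureReal_def, hup, integral_const, measure_univ]
      rw [ENNReal.toReal_ofReal hq.le]
      simp
      linarith
    · exact ((integrable_const (1 : ℝ)).indicator hm1).const_mul 2
    · exact integrable_const _
  have := strong_law_ae_real Y hint hYi hid
  filter_upwards [this] with ω hω
  rw [hmean] at hω
  have h0 := hω.eventually_lt_const (show q - p < 0 by linarith)
  obtain ⟨n, hn, hn3⟩ := (h0.and (eventually_ge_atTop 3)).exists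
  refine ⟨n, hn3, ?_⟩
  have hsum : (∑ i ∈ range n, Y i ω) = (walkS X n ω : ℝ) := by
    clear hn hn3
    induction n with
    | zero => simp [walkS_zero]
    | succ n ih => rw [Finset.sum_range_succ, ih, walkS_succ]; push_cast; rfl
  rw [hsum] at hn
  have hn' : (walkS X n ω : ℝ) < 0 := by
    by_contra hc
    push Not at hc
    exact absurd hn (not_lt.2 (div_nonneg hc (by positivity)))
  have : walkS X n ω < 0 := by exact_mod_cast hn'
  omega

end meas

/-! Pointwise facts. -/

/-- `X 1 = X 2 = 1` and the last `k` steps of the cycle are down. -/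
def T {Ω : Type*} (X : ℕ → Ω → ℤ) (k : ℕ) : Set Ω :=
  {ω | (X 1 ω = 1 ∧ X 2 ω = 1) ∧
    ∀ j ∈ Finset.Icc (cycleTau X ω - k + 1) (cycleTau X ω), X j ω = -1}

section pointwise
variable {Ω : Type*} {X : ℕ → Ω → ℤ} {ω : Ω}

lemma walkS_two (h1 : X 1 ω = 1) : walkS X 2 ω = 1 + X 2 ω := by
  have a := walkS_succ X 0 ω
  have b := walkS_succ X 1 ω
  rw [walkS_zero] at a
  simp at a b
  omega

/-- basic facts on the cycle. -/
lemma tau_facts (hpm : ∀ i, X i ω = 1 ∨ X i ω = -1) (hfin : ∃ n, 3 ≤ n ∧ walkS X n ω < 1)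
    (h1 : X 1 ω = 1) (h2 : X 2 ω = 1) :
    3 ≤ cycleTau X ω ∧ walkS X (cycleTau X ω) ω = 1 ∧
      ∀ m, 2 ≤ m → m < cycleTau X ω → 2 ≤ walkS X m ω := by
  have hw2 := walkS_two h1
  have stay : ∀ N, (∀ m, 3 ≤ m → m < N → walkS X m ω ≠ 1) →
      ∀ m, 2 ≤ m → m < N → 2 ≤ walkS X m ω := by
    intro N hN m hm
    induction m, hm using Nat.le_induction with
    | base => intro _; omega
    | succ m hm ih =>
      intro hlt
      have a := ih (by omega)
      have b := hN (m + 1) (by omega) hlt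
      have c := walkS_succ X m ω
      rcases hpm (m + 1) with h | h <;> omega
  have hne : {n : ℕ | 3 ≤ n ∧ walkS X n ω = 1}.Nonempty := by
    by_contra hc
    rw [Set.not_nonempty_iff_eq_empty] at hc
    obtain ⟨n, hn, hn'⟩ := hfin
    have := stay (n + 1) (fun m hm _ he => by
      have : m ∈ {n : ℕ | 3 ≤ n ∧ walkS X n ω = 1} := ⟨hm, he⟩
      rw [hc] at this; exact this) n (by omega) (by omega)
    omega
  have hmem : cycleTau X ω ∈ {n : ℕ | 3 ≤ n ∧ walkS X n ω = 1} := Nat.sInf_mem hne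
  refine ⟨hmem.1, hmem.2, stay _ fun m hm hlt he => ?_⟩
  exact Nat.notMem_of_lt_sInf hlt ⟨hm, he⟩

lemma walk_down {a j : ℕ} (h : ∀ i, i < j → X (a + 1 + i) ω = -1) :
    ∀ i, i ≤ j → walkS X (a + i) ω = walkS X a ω - i := by
  intro i
  induction i with
  | zero => simp
  | succ i ih =>
    intro hi
    have := walkS_succ X (a + i) ω
    have h' := h i (by omega)
    rw [show a + 1 + i = a + i + 1 by omega] at h'
    rw [← add_assoc, this, ih (by omega), h']
    push_cast; ring

lemma T_tau (hpm : ∀ i, X i ω = 1 ∨ X i ω = -1) (hfin : ∃ n, 3 ≤ n ∧ walkS X n ω < 1)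
    {k : ℕ} (h : ω ∈ T X k) : k + 2 ≤ cycleTau X ω := by
  obtain ⟨⟨h1, h2⟩, h3⟩ := h
  obtain ⟨t1, t2, t3⟩ := tau_facts hpm hfin h1 h2
  by_contra hc
  have := h3 2 (by rw [Finset.mem_Icc]; omega)
  omega

lemma Dr_tau {n k : ℕ} (hk : 1 ≤ k) (h : ω ∈ Dr X n (k + 1) k) :
    1 ≤ n ∧ cycleTau X ω = n + 1 + k := by
  obtain ⟨⟨h1, h2, h3⟩, h4⟩ := h
  have hn : 1 ≤ n := by
    by_contra hc
    obtain rfl : n = 0 := by omega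
    have a := walkS_succ X 0 ω
    rw [walkS_zero] at a
    simp at a h3
    omega
  refine ⟨hn, ?_⟩
  have hd := walk_down (X := X) (ω := ω) (a := n + 1) (j := k) h4
  apply le_antisymm
  · apply Nat.sInf_le
    refine ⟨by omega, ?_⟩
    rw [hd k le_rfl, h3]; ring
  · have hne : {n : ℕ | 3 ≤ n ∧ walkS X n ω = 1}.Nonempty :=
      ⟨n + 1 + k, by omega, by rw [hd k le_rfl, h3]; ring⟩
    have hmem : cycleTau X ω ∈ {n : ℕ | 3 ≤ n ∧ walkS X n ω = 1} := Nat.sInf_mem hne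
    obtain ⟨m1, m2⟩ := hmem
    by_contra hc
    push Not at hc
    rcases Nat.lt_or_ge (n + 1) (cycleTau X ω) with hl | hl
    · have := hd (cycleTau X ω - (n + 1)) (by omega)
      rw [show n + 1 + (cycleTau X ω - (n + 1)) = cycleTau X ω by omega] at this
      omega
    · have := h2 _ (by omega) hl
      omega

lemma T_iff (hpm : ∀ i, X i ω = 1 ∨ X i ω = -1) (hfin : ∃ n, 3 ≤ n ∧ walkS X n ω < 1)
    {k : ℕ} (hk : 1 ≤ k) : ω ∈ T X k ↔ ∃ n, ω ∈ Dr X n (k + 1) k := by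
  constructor
  · intro h
    have ht := T_tau hpm hfin h
    obtain ⟨⟨h1, h2⟩, h3⟩ := h
    obtain ⟨t1, t2, t3⟩ := tau_facts hpm hfin h1 h2
    obtain ⟨n, hn⟩ : ∃ n, cycleTau X ω = n + 1 + k := ⟨cycleTau X ω - k - 1, by omega⟩
    rw [hn] at t1 t2 t3 h3
    have hrun : ∀ i, i < k → X (n + 2 + i) ω = -1 := fun i hi =>
      h3 _ (by rw [Finset.mem_Icc]; omega)
    refine ⟨n, ⟨h1, fun m hm hm' => t3 m hm (by omega), ?_⟩, hrun⟩
    have hd := walk_down (X := X) (ω := ω) (a := n + 1) (j := k) hrun k le_rfl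
    omega
  · rintro ⟨n, h⟩
    obtain ⟨hn, ht⟩ := Dr_tau hk h
    obtain ⟨⟨h1, h2, h3⟩, h4⟩ := h
    refine ⟨⟨h1, ?_⟩, ?_⟩
    · have a := h2 2 le_rfl (by omega)
      rw [walkS_two h1] at a
      rcases hpm 2 with h | h <;> omega
    · intro j hj
      rw [ht, Finset.mem_Icc] at hj
      have := h4 (j - (n + 2)) (by omega)
      rwa [show n + 2 + (j - (n + 2)) = j by omega] at this

lemma T_one (hpm : ∀ i, X i ω = 1 ∨ X i ω = -1) (hfin : ∃ n, 3 ≤ n ∧ walkS X n ω < 1) :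
    ω ∈ T X 1 ↔ X 1 ω = 1 ∧ X 2 ω = 1 := by
  constructor
  · exact fun h => h.1
  · rintro ⟨h1, h2⟩
    obtain ⟨t1, t2, t3⟩ := tau_facts hpm hfin h1 h2
    refine ⟨⟨h1, h2⟩, fun j hj => ?_⟩
    rw [Finset.mem_Icc] at hj
    obtain rfl : j = cycleTau X ω := by omega
    obtain ⟨n, hn⟩ : ∃ n, cycleTau X ω = n + 1 := ⟨cycleTau X ω - 1, by omega⟩
    rw [hn] at t2 t3 t1 ⊢
    have a := t3 n (by omega) (by omega)
    have b := walkS_succ X n ω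
    rcases hpm (n + 1) with h | h <;> omega

lemma E_iff (hpm : ∀ i, X i ω = 1 ∨ X i ω = -1) (hfin : ∃ n, 3 ≤ n ∧ walkS X n ω < 1)
    (k : ℕ) : ((X 1 ω = 1 ∧ X 2 ω = 1) ∧ X (cycleTau X ω - k) ω = 1 ∧
          ∀ j ∈ Finset.Icc (cycleTau X ω - k + 1) (cycleTau X ω), X j ω = -1) ↔
      ω ∈ T X k ∧ ω ∉ T X (k + 1) := by
  constructor
  · rintro ⟨hA, h1, h2⟩
    refine ⟨⟨hA, h2⟩, fun h => ?_⟩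
    have := T_tau hpm hfin h
    have := h.2 (cycleTau X ω - k) (by rw [Finset.mem_Icc]; omega)
    omega
  · rintro ⟨h, h'⟩
    refine ⟨h.1, ?_, h.2⟩
    by_contra hc
    have hc' := (hpm (cycleTau X ω - k)).resolve_left hc
    have := T_tau hpm hfin h
    refine h' ⟨h.1, fun j hj => ?_⟩
    rw [Finset.mem_Icc] at hj
    by_cases hj' : j = cycleTau X ω - k
    · rw [hj']; exact hc'
    · exact h.2 j (by rw [Finset.mem_Icc]; omega)

lemma T_succ_subset (k : ℕ) : T X (k + 1) ⊆ T X k := by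
  rintro ω ⟨h, h'⟩
  refine ⟨h, fun j hj => h' j ?_⟩
  rw [Finset.mem_Icc] at hj ⊢
  omega

end pointwise

section meas2
variable {Ω : Type*} [MeasurableSpace Ω] {μ : Measure Ω} [IsProbabilityMeasure μ]
  {X : ℕ → Ω → ℤ}

lemma T_ae (hpm : ∀ᵐ ω ∂μ, ∀ i, X i ω = 1 ∨ X i ω = -1)
    (hfin : ∀ᵐ ω ∂μ, ∃ n, 3 ≤ n ∧ walkS X n ω < 1) {k : ℕ} (hk : 1 ≤ k) :
    T X k =ᵐ[μ] ⋃ n, Dr X n (k + 1) k := by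
  filter_upwards [hpm, hfin] with ω h1 h2
  apply propext
  change ω ∈ T X k ↔ ω ∈ ⋃ n, Dr X n (k + 1) k
  rw [T_iff h1 h2 hk, Set.mem_iUnion]

lemma measure_T (hmeas : ∀ i, Measurable (X i)) (hindep : iIndepFun X μ) {P : ENNReal}
    (hdown : ∀ i, μ {ω | X i ω = -1} = P)
    (hpm : ∀ᵐ ω ∂μ, ∀ i, X i ω = 1 ∨ X i ω = -1)
    (hfin : ∀ᵐ ω ∂μ, ∃ n, 3 ≤ n ∧ walkS X n ω < 1) {k : ℕ} (hk : 1 ≤ k) :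
    μ (T X k) = (∑' n, μ (D X n (k + 1))) * P ^ k := by
  rw [measure_congr (T_ae hpm hfin hk), measure_iUnion]
  · simp_rw [measure_Dr hmeas hindep hdown, ENNReal.tsum_mul_right]
  · intro i j hij
    rw [Function.onFun, Set.disjoint_left]
    intro ω hi hj
    have a := (Dr_tau hk hi).2
    have b := (Dr_tau hk hj).2
    omega
  · exact fun n => (Dr_dep X n _ k).measurableSet hmeas

lemma green_rec (hmeas : ∀ i, Measurable (X i)) (hindep : iIndepFun X μ) {P Q : ENNReal}
    (hup : ∀ i, μ {ω | X i ω = 1} = Q)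
    (hdown : ∀ i, μ {ω | X i ω = -1} = P)
    (hpm : ∀ᵐ ω ∂μ, ∀ i, X i ω = 1 ∨ X i ω = -1) (y : ℤ) (hy : 2 ≤ y) :
    (∑' n, μ (D X n y)) = (∑' n, μ (D X n (y - 1))) * Q + (∑' n, μ (D X n (y + 1))) * P := by
  rw [tsum_eq_zero_add' ENNReal.summable, D_zero_of_two_le y hy, measure_empty, zero_add]
  simp_rw [D_step hmeas hindep hup hdown hpm _ y hy]
  rw [ENNReal.tsum_add, ENNReal.tsum_mul_right, ENNReal.tsum_mul_right]

lemma green_one {Q : ENNReal} (hup : ∀ i, μ {ω | X i ω = 1} = Q) :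
    (∑' n, μ (D X n 1)) = Q := by
  rw [tsum_eq_zero_add' ENNReal.summable, D_zero_one, hup]
  simp [D_succ_one]

lemma measure_A (hindep : iIndepFun X μ) {Q : ENNReal}
    (hup : ∀ i, μ {ω | X i ω = 1} = Q) : μ {ω | X 1 ω = 1 ∧ X 2 ω = 1} = Q * Q := by
  have := (hindep.indepFun (i := 1) (j := 2) (by omega)).measure_inter_preimage_eq_mul {1} {1}
    (measurableSet_singleton _) (measurableSet_singleton _)
  have h1 : μ (X 1 ⁻¹' {1}) = Q := hup 1
  have h2 : μ (X 2 ⁻¹' {1}) = Q := hup 2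
  rw [h1, h2] at this
  exact this

lemma solve {p a c : ℝ} (hp : 0 < p) (ha : 0 ≤ a) (hc : 0 ≤ c) {G : ENNReal}
    (h : ENNReal.ofReal (a + c * p) = ENNReal.ofReal a + G * ENNReal.ofReal p) :
    G = ENNReal.ofReal c := by
  rw [ENNReal.ofReal_add ha (by positivity), ENNReal.ofReal_mul hc] at h
  have h' := (ENNReal.add_right_inj ENNReal.ofReal_ne_top).1 h
  exact ((ENNReal.mul_left_inj (by simpa using hp) ENNReal.ofReal_ne_top).1 h').symm

lemma measure_T_eq (hmeas : ∀ i, Measurable (X i)) (hindep : iIndepFun X μ)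
    {q p : ℝ} (hq : 0 < q) (hp0 : 0 < p) (hp : p = 1 - q)
    (hup : ∀ i, μ {ω | X i ω = 1} = ENNReal.ofReal q)
    (hdown : ∀ i, μ {ω | X i ω = -1} = ENNReal.ofReal p)
    (hpm : ∀ᵐ ω ∂μ, ∀ i, X i ω = 1 ∨ X i ω = -1)
    (hfin : ∀ᵐ ω ∂μ, ∃ n, 3 ≤ n ∧ walkS X n ω < 1) {k : ℕ} (hk : 1 ≤ k) :
    μ (T X k) = ENNReal.ofReal (q ^ (k + 1)) := by
  have h1 : μ (T X 1) = ENNReal.ofReal q * ENNReal.ofReal q := by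
    rw [← measure_A hindep hup]
    apply measure_congr
    filter_upwards [hpm, hfin] with ω a b
    exact propext (T_one a b)
  have hg : ∀ m : ℕ, (∑' n, μ (D X n ((m : ℤ) + 1))) = ENNReal.ofReal (q ^ (m + 1) / p ^ m) ∧
      (∑' n, μ (D X n ((m : ℤ) + 2))) = ENNReal.ofReal (q ^ (m + 2) / p ^ (m + 1)) := by
    intro m
    induction m with
    | zero =>
      constructor
      · simpa using green_one hup
      · have h := measure_T hmeas hindep hdown hpm hfin (k := 1) le_rfl
        rw [h1] at h
        apply solve hp0 le_rfl (by positivity)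
        simp only [ENNReal.ofReal_zero, zero_add]
        norm_num at h ⊢
        rw [← h, ← ENNReal.ofReal_mul hq.le]
        congr 1
        field_simp
    | succ m ih =>
      refine ⟨?_, ?_⟩
      · rw [← ih.2]; push_cast; simp only [add_assoc]; norm_num
      · have h := green_rec hmeas hindep hup hdown hpm ((m : ℤ) + 2) (by omega)
        rw [show (m : ℤ) + 2 - 1 = m + 1 by ring, ih.1, ih.2,
          show (m : ℤ) + 2 + 1 = (m + 1 : ℕ) + 2 by push_cast; ring,
          ← ENNReal.ofReal_mul (by positivity)] at h
        apply solve hp0 (a := q ^ (m + 1) / p ^ m * q) (by positivity) (by positivity)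
        rw [← h]
        congr 1
        have : q = 1 - p := by linarith
        field_simp
        rw [hp]; ring
  rw [measure_T hmeas hindep hdown hpm hfin hk, (hg k).1, ← ENNReal.ofReal_pow hp0.le,
    ← ENNReal.ofReal_mul (by positivity)]
  congr 1
  field_simp

end meas2

end SM

open SM

theorem stmt13 {Ω : Type*} [MeasureSpace Ω] [IsProbabilityMeasure (ℙ : Measure Ω)]
    (q p : ℝ) (hq : 0 < q) (hq1 : q < 1 / 2) (hp : p = 1 - q)
    (X : ℕ → Ω → ℤ) (hmeas : ∀ i, Measurable (X i))
    (hindep : iIndepFun X ℙ)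
    (hup : ∀ i, ℙ {ω | X i ω = 1} = ENNReal.ofReal q)
    (hdown : ∀ i, ℙ {ω | X i ω = -1} = ENNReal.ofReal p)
    (k : ℕ) (hk : 1 ≤ k) :
    ((ℙ : Measure Ω)[|{ω | X 1 ω = 1 ∧ X 2 ω = 1}])
        {ω | X (cycleTau X ω - k) ω = 1 ∧
          ∀ j ∈ Finset.Icc (cycleTau X ω - k + 1) (cycleTau X ω), X j ω = -1}
      = ENNReal.ofReal (p * q ^ (k - 1)) := by
  have hp0 : 0 < p := by linarith
  have hpm := hpm_of hmeas hq hp0 hp hup hdown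
  have hfin := tau_fin hmeas hindep hq hq1 hp hup hdown
  have hA : MeasurableSet {ω | X 1 ω = 1 ∧ X 2 ω = 1} :=
    (hmeas 1 (measurableSet_singleton 1)).inter (hmeas 2 (measurableSet_singleton 1))
  have hT : ∀ k, 1 ≤ k → (ℙ : Measure Ω) (T X k) = ENNReal.ofReal (q ^ (k + 1)) := fun k hk =>
    measure_T_eq hmeas hindep hq hp0 hp hup hdown hpm hfin hk
  have hE : (ℙ : Measure Ω) ({ω | X 1 ω = 1 ∧ X 2 ω = 1} ∩ {ω | X (cycleTau X ω - k) ω = 1 ∧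
          ∀ j ∈ Finset.Icc (cycleTau X ω - k + 1) (cycleTau X ω), X j ω = -1}) =
      (ℙ : Measure Ω) (T X k \ T X (k + 1)) := by
    apply measure_congr
    filter_upwards [hpm, hfin] with ω a b
    exact propext (E_iff a b k)
  have hTm : NullMeasurableSet (T X (k + 1)) (ℙ : Measure Ω) :=
    (MeasurableSet.iUnion fun n => (Dr_dep X n _ (k + 1)).measurableSet hmeas).nullMeasurableSet.congr
      (T_ae hpm hfin (by omega)).symm
  rw [cond_apply hA, hE, measure_sdiff (T_succ_subset k) hTm (measure_ne_top _ _), hT k hk,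
    hT (k + 1) (by omega), measure_A hindep hup, ← ENNReal.ofReal_sub _ (by positivity),
    ← ENNReal.ofReal_mul hq.le, ← ENNReal.ofReal_inv_of_pos (by positivity),
    ← ENNReal.ofReal_mul (by positivity)]
  congr 1
  obtain ⟨j, rfl⟩ : ∃ j, k = j + 1 := ⟨k - 1, by omega⟩
  simp only [Nat.add_sub_cancel]
  rw [hp]
  field_simp
  ring
end

section
/- Assume 0 < q < 1/2, let γ ∈ [0,1], and let n₁ ≥ 2 be an integer. Let (B_i)_{i≥1} be i.i.d. Bernoulli(γ) random variables independent of (X_i). Define the number U of referred uncles of the attack cycle by: U = 0 if X_1 = −1; U = 1 if X_1 = +1 and X_2 = −1; and if X_1 = X_2 = +1, U = Σ_{i=3}^{τ} 1_{(S_i < S_{i−1}) ∧ (S_i < n₁)} · max(B_i, 1_{i = f}), where f = inf{i ≥ 3 : X_i = −1} is the index of the first honest block of the cycle. Then E[U] = q + q³γ/(p − q) − (p³/(p − q)) (q/p)^{n₁+1} γ − q^{n₁+1}(1 − γ). -/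
open MeasureTheory ProbabilityTheory Filter Finset

/-- The index `f = inf {i ≥ 3 : X_i = -1}` of the first honest block of a cycle
starting `SS` (`sInf ∅ = 0` by convention). -/
noncomputable def firstHonest {Ω : Type*} (X : ℕ → Ω → ℤ) (ω : Ω) : ℕ :=
  sInf {i : ℕ | 3 ≤ i ∧ X i ω = -1}

/-- The number of referred uncles of the attack cycle in Strategy 1: each eligible honest
block (a descent landing strictly below `n₁`) is referred with probability `γ`
(Bernoulli variable `B i`), except the first honest block which is referred for sure. -/
noncomputable def unclesU {Ω : Type*} (X B : ℕ → Ω → ℤ) (n₁ : ℕ) (ω : Ω) : ℤ :=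
  if X 1 ω = -1 then 0
  else if X 2 ω = -1 then 1
  else ∑ i ∈ Finset.Icc 3 (cycleTau X ω),
    if walkS X i ω < walkS X (i - 1) ω ∧ walkS X i ω < n₁ then
      max (B i ω) (if i = firstHonest X ω then 1 else 0)
    else 0

/-! ### Deterministic path functionals -/

noncomputable def sx (x : ℕ → ℤ) (n : ℕ) : ℤ := ∑ i ∈ Finset.Icc 1 n, x i

lemma sx_succ (x : ℕ → ℤ) (n : ℕ) : sx x (n + 1) = sx x n + x (n + 1) := by
  unfold sx
  rw [Finset.sum_Icc_succ_top (by omega)]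

/-- The cycle is still running at time `n + 2`. -/
def Alive (x : ℕ → ℤ) : ℕ → Prop
  | 0 => x 1 = 1 ∧ x 2 = 1
  | n + 1 => Alive x n ∧ (x (n + 3) = 1 ∨ x (n + 3) = -1) ∧ 2 ≤ sx x (n + 3)

lemma sx_two (x : ℕ → ℤ) : sx x 2 = x 1 + x 2 := by
  simp [sx, Finset.sum_Icc_succ_top]

lemma Alive.bounds {x : ℕ → ℤ} {n : ℕ} (h : Alive x n) :
    2 ≤ sx x (n + 2) ∧ sx x (n + 2) ≤ n + 2 := by
  induction n with
  | zero => obtain ⟨h1, h2⟩ := h; simp [sx_two, h1, h2]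
  | succ n ih =>
    obtain ⟨h1, h2, h3⟩ := h
    have := ih h1
    refine ⟨h3, ?_⟩
    have e := sx_succ x (n + 2)
    push_cast
    rw [show n + 1 + 2 = n + 2 + 1 from rfl, e]
    rcases h2 with h2 | h2 <;> (rw [show n + 2 + 1 = n + 3 from rfl, h2]; omega)

def Past (N : ℕ) (G : (ℕ → ℤ) → ℝ) : Prop :=
  ∀ x y : ℕ → ℤ, (∀ i ∈ Finset.Icc 1 N, x i = y i) → G x = G y

lemma sx_congr {N n : ℕ} {x y : ℕ → ℤ} (h : ∀ i ∈ Finset.Icc 1 N, x i = y i) (hn : n ≤ N) :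
    sx x n = sx y n := by
  unfold sx
  apply Finset.sum_congr rfl
  intro i hi
  apply h
  simp only [Finset.mem_Icc] at *
  omega

lemma alive_congr {N n : ℕ} {x y : ℕ → ℤ} (h : ∀ i ∈ Finset.Icc 1 N, x i = y i)
    (hn : n + 2 ≤ N) : Alive x n ↔ Alive y n := by
  induction n with
  | zero =>
    simp only [Alive]
    rw [h 1 (by simp; omega), h 2 (by simp; omega)]
  | succ n ih =>
    simp only [Alive]
    rw [ih (by omega), h (n + 3) (by simp; omega), sx_congr h (n := n + 3) (by omega)]

open Classical in
/-- functional of the current position on the event that the cycle is running -/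
noncomputable def onAlive (n : ℕ) (g : ℤ → ℝ) (x : ℕ → ℤ) : ℝ :=
  if Alive x n then g (sx x (n + 2)) else 0

lemma onAlive_past (n : ℕ) (g : ℤ → ℝ) : Past (n + 2) (onAlive n g) := by
  intro x y h
  unfold onAlive
  rw [alive_congr h le_rfl, sx_congr h le_rfl]

lemma onAlive_bdd (n : ℕ) (g : ℤ → ℝ) : ∃ C, ∀ x, |onAlive n g x| ≤ C := by
  refine ⟨∑ s ∈ Finset.Icc (2 : ℤ) (n + 2), |g s|, fun x => ?_⟩
  unfold onAlive
  split_ifs with h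
  · exact Finset.single_le_sum (f := fun s => |g s|) (fun _ _ => abs_nonneg _)
      (Finset.mem_Icc.2 h.bounds)
  · simp only [abs_zero]
    exact Finset.sum_nonneg fun _ _ => abs_nonneg _

/-- one-step decomposition -/
lemma onAlive_succ (n : ℕ) (g : ℤ → ℝ) (x : ℕ → ℤ) :
    onAlive (n + 1) g x =
      onAlive n (fun s => g (s + 1)) x * (if x (n + 3) = 1 then 1 else 0) +
      onAlive n (fun s => if 3 ≤ s then g (s - 1) else 0) x *
        (if x (n + 3) = -1 then 1 else 0) := by
  unfold onAlive
  have e : sx x (n + 3) = sx x (n + 2) + x (n + 3) := sx_succ x (n + 2)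
  by_cases h : Alive x n
  · have hb := h.bounds
    by_cases h1 : x (n + 3) = 1
    · have : Alive x (n + 1) := ⟨h, Or.inl h1, by omega⟩
      simp [h, h1, this]
      rw [show n + 1 + 2 = n + 3 from rfl, e, h1]
    · by_cases h2 : x (n + 3) = -1
      · by_cases h3 : 3 ≤ sx x (n + 2)
        · have : Alive x (n + 1) := ⟨h, Or.inr h2, by omega⟩
          simp [h, h2, this, h3]
          rw [show n + 1 + 2 = n + 3 from rfl, e, h2]
          rfl
        · have : ¬ Alive x (n + 1) := fun h => by
            have := h.2.2
            omega
          simp [h, h2, this, h3]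
      · have : ¬ Alive x (n + 1) := fun h => by
          have := h.2.1
          tauto
        simp [h1, h2, this]
  · have : ¬ Alive x (n + 1) := fun h' => h h'.1
    simp [h, this]

/-! ### Value functions -/

noncomputable def dd (r : ℝ) (n₁ j : ℕ) : ℝ := ∑ k ∈ Finset.range (n₁ - 1 - j), r ^ k

noncomputable def HH (r : ℝ) (n₁ m : ℕ) : ℝ := ∑ j ∈ Finset.range m, dd r n₁ j

noncomputable def ww (q : ℝ) (n₁ N : ℕ) : ℝ := 1 - q ^ (n₁ + 1 - N)

lemma dd_step (q p : ℝ) (hp : 0 < p) (n₁ u : ℕ) :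
    q * dd (q / p) n₁ (u + 1) + p * (if u + 1 < n₁ then 1 else 0) = p * dd (q / p) n₁ u := by
  unfold dd
  split_ifs with h
  · rw [show n₁ - 1 - u = (n₁ - 1 - (u + 1)) + 1 by omega, Finset.sum_range_succ']
    simp only [pow_succ, ← Finset.sum_mul]
    field_simp
  · rw [show n₁ - 1 - u = 0 by omega, show n₁ - 1 - (u + 1) = 0 by omega]
    simp

lemma HH_step (q p : ℝ) (hp : 0 < p) (hpq : p = 1 - q) (n₁ u : ℕ) :
    q * HH (q / p) n₁ (u + 2) + p * (if u + 1 < n₁ then 1 else 0) + p * HH (q / p) n₁ u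
      = HH (q / p) n₁ (u + 1) := by
  have := dd_step q p hp n₁ u
  have e1 : HH (q / p) n₁ (u + 1) = HH (q / p) n₁ u + dd (q / p) n₁ u :=
    Finset.sum_range_succ _ _
  have e2 : HH (q / p) n₁ (u + 2) = HH (q / p) n₁ (u + 1) + dd (q / p) n₁ (u + 1) :=
    Finset.sum_range_succ _ _
  rw [e2, e1]
  subst hpq
  linear_combination this

lemma ww_step (q p : ℝ) (hpq : p = 1 - q) (n₁ N : ℕ) (hN : 1 ≤ N) :
    ww q n₁ N = p * (if N - 1 < n₁ then 1 else 0) + q * ww q n₁ (N + 1) := by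
  unfold ww
  split_ifs with h
  · rw [show n₁ + 1 - N = (n₁ + 1 - (N + 1)) + 1 by omega, pow_succ, hpq]
    ring
  · rw [show n₁ + 1 - N = 0 by omega, show n₁ + 1 - (N + 1) = 0 by omega]
    simp

lemma dd_nonneg {r : ℝ} (hr : 0 ≤ r) (n₁ j : ℕ) : 0 ≤ dd r n₁ j :=
  Finset.sum_nonneg fun _ _ => pow_nonneg hr _

lemma HH_nonneg {r : ℝ} (hr : 0 ≤ r) (n₁ m : ℕ) : 0 ≤ HH r n₁ m :=
  Finset.sum_nonneg fun _ _ => dd_nonneg hr _ _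

lemma HH_le {r : ℝ} (hr : 0 ≤ r) (n₁ m : ℕ) : HH r n₁ m ≤ HH r n₁ n₁ := by
  unfold HH
  rcases le_total m n₁ with h | h
  · exact Finset.sum_le_sum_of_subset_of_nonneg (Finset.range_mono h)
      fun _ _ _ => dd_nonneg hr _ _
  · apply le_of_eq
    symm
    apply Finset.sum_subset (Finset.range_mono h)
    intro j _ hj
    simp only [Finset.mem_range, not_lt] at hj
    unfold dd
    rw [show n₁ - 1 - j = 0 by omega]
    simp

noncomputable def vv (q p γ : ℝ) (n₁ n : ℕ) (s : ℤ) : ℝ :=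
  γ * HH (q / p) n₁ (s - 1).toNat + (1 - γ) * (if s = n + 2 then ww q n₁ (n + 2) else 0)

/-- The key harmonicity relation. -/
lemma vv_step (q p γ : ℝ) (hp : 0 < p) (hpq : p = 1 - q) (n₁ n : ℕ) (s : ℤ) (h2 : 2 ≤ s)
    (hs : s ≤ n + 2) :
    q * vv q p γ n₁ (n + 1) (s + 1) +
     p * γ * (if s - 1 < n₁ ∧ s ≠ n + 2 then 1 else 0) +
     p * ((if s - 1 < n₁ ∧ s = n + 2 then 1 else 0) +
        (if 3 ≤ s then vv q p γ n₁ (n + 1) (s - 1) else 0)) = vv q p γ n₁ n s := by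
  obtain ⟨u, rfl⟩ : ∃ u : ℕ, s = u + 2 := ⟨(s - 2).toNat, by omega⟩
  have key := HH_step q p hp hpq n₁ u
  have hw := ww_step q p hpq n₁ (n + 2) (by omega)
  have e0 : (if 3 ≤ (u : ℤ) + 2 then vv q p γ n₁ (n + 1) ((u : ℤ) + 2 - 1) else 0)
      = γ * HH (q / p) n₁ u := by
    split_ifs with h
    · unfold vv
      rw [if_neg (by push_cast; omega), show ((u : ℤ) + 2 - 1 - 1).toNat = u by omega]
      ring
    · have : u = 0 := by omega
      subst this
      simp [HH]
  rw [e0]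
  unfold vv
  rw [show ((u : ℤ) + 2 + 1 - 1).toNat = u + 2 by omega,
    show ((u : ℤ) + 2 - 1).toNat = u + 1 by omega]
  have c1 : ((u : ℤ) + 2 - 1 < n₁) ↔ u + 1 < n₁ := by omega
  have c2 : ((u : ℤ) + 2 = n + 2) ↔ u = n := by omega
  have c3 : ((u : ℤ) + 2 + 1 = ((n + 1 : ℕ) : ℤ) + 2) ↔ u = n := by push_cast; omega
  simp only [c1, c2, c3, ne_eq]
  by_cases hu : u = n
  · subst hu
    simp only [if_true, not_true_eq_false, and_false, if_false, and_true]
    rw [show u + 2 - 1 = u + 1 by omega] at hw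
    rw [show u + 1 + 2 = u + 2 + 1 from rfl, hw]
    linear_combination γ * key
  · simp only [hu, if_false, and_false, not_false_eq_true, and_true]
    linear_combination γ * key

/-- Reward collected at block `n + 3`. -/
noncomputable def rew (n₁ n : ℕ) (x b : ℕ → ℤ) : ℝ :=
  onAlive n (fun s => if s - 1 < n₁ ∧ s ≠ n + 2 then 1 else 0) x *
      ((if x (n + 3) = -1 then 1 else 0) * (if b (n + 3) = 1 then 1 else 0)) +
  onAlive n (fun s => if s - 1 < n₁ ∧ s = n + 2 then 1 else 0) x *
      (if x (n + 3) = -1 then 1 else 0)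

lemma onAlive_nonneg (n : ℕ) (g : ℤ → ℝ) (hg : ∀ s, 0 ≤ g s) (x : ℕ → ℤ) :
    0 ≤ onAlive n g x := by
  unfold onAlive
  split_ifs
  · exact hg _
  · exact le_rfl

lemma rew_nonneg (n₁ n : ℕ) (x b : ℕ → ℤ) : 0 ≤ rew n₁ n x b := by
  unfold rew
  have h1 := onAlive_nonneg n (fun s => if s - 1 < n₁ ∧ s ≠ n + 2 then 1 else 0)
    (fun s => by split_ifs <;> norm_num) x
  have h2 := onAlive_nonneg n (fun s => if s - 1 < n₁ ∧ s = n + 2 then 1 else 0)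
    (fun s => by split_ifs <;> norm_num) x
  have h3 : (0 : ℝ) ≤ (if x (n + 3) = -1 then 1 else 0) := by split_ifs <;> norm_num
  have h4 : (0 : ℝ) ≤ (if b (n + 3) = 1 then 1 else 0) := by split_ifs <;> norm_num
  positivity

/-! ### Path identity -/

lemma alive_anti {x : ℕ → ℤ} {m n : ℕ} (h : m ≤ n) (hn : Alive x n) : Alive x m := by
  induction n, h using Nat.le_induction with
  | base => exact hn
  | succ n _ ih => exact ih hn.1

lemma sx_eq_iff {x : ℕ → ℤ} {n : ℕ} (h : Alive x n) :
    sx x (n + 2) = n + 2 ↔ ∀ j, 3 ≤ j → j < n + 3 → x j ≠ -1 := by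
  induction n with
  | zero =>
    obtain ⟨h1, h2⟩ := h
    refine ⟨fun _ j _ _ => by omega, fun _ => ?_⟩
    have := sx_two x
    rw [h1, h2] at this
    simpa using this
  | succ n ih =>
    have hb := h.1.bounds
    have e : sx x (n + 1 + 2) = sx x (n + 2) + x (n + 3) := sx_succ x (n + 2)
    rw [e]
    push_cast
    constructor
    · intro h' j h3 hj
      rcases h.2.1 with hx | hx
      · rcases Nat.lt_succ_iff_lt_or_eq.1 hj with hj | hj
        · exact (ih h.1).1 (by omega) j h3 (by omega)
        · rw [hj, show n + 1 + 2 = n + 3 from rfl, hx]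
          decide
      · omega
    · intro h'
      have := (ih h.1).2 (fun j h3 hj => h' j h3 (by omega))
      have hx := h' (n + 3) (by omega) (by omega)
      rcases h.2.1 with hx' | hx'
      · omega
      · exact absurd hx' hx

lemma path_identity {Ω : Type*} (X B : ℕ → Ω → ℤ) (n₁ : ℕ) (ω : Ω)
    (hX : ∀ i, X i ω = 1 ∨ X i ω = -1) (hB : ∀ i, B i ω = 1 ∨ B i ω = 0)
    (hfin : ∃ n, ¬ Alive (fun i => X i ω) n) :
    (unclesU X B n₁ ω : ℝ) =
      (if X 1 ω = 1 then 1 else 0) * (if X 2 ω = -1 then 1 else 0) +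
        ∑' n, rew n₁ n (fun i => X i ω) (fun i => B i ω) := by
  classical
  set x : ℕ → ℤ := fun i => X i ω with hx
  set b : ℕ → ℤ := fun i => B i ω with hb
  have dead : ∀ n, ¬ Alive x n → rew n₁ n x b = 0 := by
    intro n hn
    simp [rew, onAlive, hn]
  by_cases hss : Alive x 0
  · have h1 : X 1 ω = 1 := hss.1
    have h2 : X 2 ω = 1 := hss.2
    let N := Nat.find hfin
    have hN : ¬ Alive x N := Nat.find_spec hfin
    have hlt : ∀ m < N, Alive x m := fun m hm => not_not.1 (Nat.find_min hfin hm)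
    have hN0 : N ≠ 0 := fun h => hN (h ▸ hss)
    obtain ⟨M, hM⟩ := Nat.exists_eq_succ_of_ne_zero hN0
    have hMa : Alive x M := hlt M (by omega)
    have eM : sx x (M + 3) = sx x (M + 2) + x (M + 3) := sx_succ x (M + 2)
    have hM1 : sx x (M + 3) = 1 := by
      have hbd := hMa.bounds
      have : ¬ (2 ≤ sx x (M + 3)) := fun h => hN (by
        rw [hM]; exact ⟨hMa, hX _, h⟩)
      have hx3 : x (M + 3) = 1 ∨ x (M + 3) = -1 := hX (M + 3)
      omega
    have htau : cycleTau X ω = M + 3 := by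
      unfold cycleTau
      apply le_antisymm
      · exact Nat.sInf_le ⟨by omega, hM1⟩
      · refine le_csInf ⟨M + 3, by omega, hM1⟩ ?_
        rintro k ⟨hk3, hk⟩
        by_contra hlt'
        have := (hlt (k - 2) (by omega)).bounds.1
        rw [show k - 2 + 2 = k by omega] at this
        have hk' : sx x k = 1 := hk
        omega
    have hdead : ∀ n, n ∉ Finset.range (M + 1) → rew n₁ n x b = 0 := by
      intro n hn
      apply dead
      intro h
      exact hN (alive_anti (by simp at hn; omega) h)
    rw [tsum_eq_sum hdead]
    unfold unclesU
    rw [if_neg (by rw [h1]; decide), if_neg (by rw [h2]; decide), if_neg (c := X 2 ω = -1) (by rw [h2]; decide)]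
    rw [htau, mul_zero, zero_add, ← Finset.Ico_add_one_right_eq_Icc, Finset.sum_Ico_eq_sum_range]
    rw [show M + 3 + 1 - 3 = M + 1 by omega]
    push_cast
    apply Finset.sum_congr rfl
    intro n hn
    have ha : Alive x n := hlt n (by simp at hn; omega)
    have en : sx x (n + 3) = sx x (n + 2) + x (n + 3) := sx_succ x (n + 2)
    have w1 : walkS X (3 + n) ω = sx x (n + 2) + x (n + 3) := by
      rw [← en, add_comm]; rfl
    have w2 : walkS X (3 + n - 1) ω = sx x (n + 2) := by
      rw [show 3 + n - 1 = n + 2 by omega]; rfl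
    have hxn : x (n + 3) = 1 ∨ x (n + 3) = -1 := hX (n + 3)
    have hbn : b (n + 3) = 1 ∨ b (n + 3) = 0 := hB (n + 3)
    have hbe : B (3 + n) ω = b (n + 3) := by rw [add_comm]
    rw [w1, w2, hbe]
    unfold rew onAlive
    simp only [ha, if_true]
    rcases hxn with hxn | hxn
    · simp [hxn]
    · have hf : (3 + n = firstHonest X ω) ↔ sx x (n + 2) = n + 2 := by
        rw [sx_eq_iff ha]
        have hmem : n + 3 ∈ {i : ℕ | 3 ≤ i ∧ X i ω = -1} := ⟨by omega, hxn⟩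
        constructor
        · intro h j hj3 hj hxj
          have : firstHonest X ω ≤ j := Nat.sInf_le ⟨hj3, hxj⟩
          omega
        · intro h
          apply le_antisymm
          · refine le_csInf ⟨_, hmem⟩ ?_
            rintro k ⟨hk3, hk⟩
            by_contra hk'
            exact h k hk3 (by omega) hk
          · rw [add_comm]; exact Nat.sInf_le hmem
      simp only [hf, hxn]
      rw [show sx x (n + 2) + -1 = sx x (n + 2) - 1 from rfl]
      by_cases c1 : sx x (n + 2) - 1 < n₁ <;> by_cases c2 : sx x (n + 2) = n + 2 <;>
        rcases hbn with hbn | hbn <;> simp [c1, c2, hbn]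
  · have hall : ∀ n, rew n₁ n x b = 0 := fun n => dead n fun h => hss (alive_anti (Nat.zero_le _) h)
    simp only [hall, tsum_zero, add_zero]
    unfold unclesU
    rcases hX 1 with h1 | h1
    · rcases hX 2 with h2 | h2
      · exact absurd ⟨h1, h2⟩ hss
      · simp [h1, h2]
    · simp [h1]

/-! ### Probability -/

section Prob

variable {Ω : Type*} [MeasurableSpace Ω] {μ : Measure Ω} [IsProbabilityMeasure μ]
  {X B : ℕ → Ω → ℤ}

lemma past_factor {N : ℕ} {G : (ℕ → ℤ) → ℝ} (hG : Past N G) :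
    ∃ φ : ((i : ((Finset.Icc 1 N).map Function.Embedding.inl : Finset (ℕ ⊕ ℕ))) → ℤ) → ℝ,
      ∀ ω : Ω, G (fun i => X i ω) =
        φ (fun i => Sum.elim X B i.1 ω) := by
  refine ⟨fun y => G (fun i => if h : (Sum.inl i : ℕ ⊕ ℕ) ∈
    ((Finset.Icc 1 N).map Function.Embedding.inl : Finset (ℕ ⊕ ℕ)) then y ⟨Sum.inl i, h⟩ else 0), ?_⟩
  intro ω
  apply hG
  intro i hi
  rw [dif_pos]
  · rfl
  · exact Finset.mem_map_of_mem _ hi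

lemma past_measurable (hmeasX : ∀ i, Measurable (X i)) (hmeasB : ∀ i, Measurable (B i))
    {N : ℕ} {G : (ℕ → ℤ) → ℝ} (hG : Past N G) :
    Measurable (fun ω => G (fun i => X i ω)) := by
  obtain ⟨φ, hφ⟩ := past_factor (X := X) (B := B) hG
  simp_rw [hφ]
  refine (measurable_of_countable φ).comp ?_
  refine measurable_pi_lambda _ fun i => ?_
  rcases i with ⟨i | i, hi⟩
  · exact hmeasX i
  · exact hmeasB i

lemma past_integral (hmeasX : ∀ i, Measurable (X i)) (hmeasB : ∀ i, Measurable (B i))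
    (hindep : iIndepFun (Sum.elim X B) μ)
    {N : ℕ} {G : (ℕ → ℤ) → ℝ} (hG : Past N G) (ψ : ℤ → ℤ → ℝ) :
    ∫ ω, G (fun i => X i ω) * ψ (X (N + 1) ω) (B (N + 1) ω) ∂μ =
      (∫ ω, G (fun i => X i ω) ∂μ) * ∫ ω, ψ (X (N + 1) ω) (B (N + 1) ω) ∂μ := by
  obtain ⟨φ, hφ⟩ := past_factor (X := X) (B := B) hG
  let T : Finset (ℕ ⊕ ℕ) := {Sum.inl (N + 1), Sum.inr (N + 1)}
  have hm : ∀ i, Measurable (Sum.elim X B i) := by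
    rintro (i | i)
    · exact hmeasX i
    · exact hmeasB i
  have hd : Disjoint ((Finset.Icc 1 N).map Function.Embedding.inl : Finset (ℕ ⊕ ℕ)) T := by
    rw [Finset.disjoint_left]
    intro a ha hT
    simp only [Finset.mem_map, Finset.mem_Icc, T, Finset.mem_insert, Finset.mem_singleton] at ha hT
    obtain ⟨k, hk, rfl⟩ := ha
    rcases hT with h | h
    · have : k = N + 1 := Sum.inl_injective h
      omega
    · cases h
  have hi := hindep.indepFun_finset _ T hd hm
  let χ : (T → ℤ) → ℝ := fun y =>
    ψ (y ⟨Sum.inl (N + 1), by simp [T]⟩) (y ⟨Sum.inr (N + 1), by simp [T]⟩)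
  have hi2 := hi.comp (measurable_of_countable φ) (measurable_of_countable χ)
  have hmG := past_measurable hmeasX hmeasB hG
  have hmψ : Measurable (fun ω => ψ (X (N + 1) ω) (B (N + 1) ω)) :=
    (measurable_of_countable (fun z : ℤ × ℤ => ψ z.1 z.2)).comp
      ((hmeasX (N + 1)).prodMk (hmeasB (N + 1)))
  have hi3 : IndepFun (fun ω => G (fun i => X i ω))
      (fun ω => ψ (X (N + 1) ω) (B (N + 1) ω)) μ := by
    simp_rw [hφ]
    exact hi2
  exact hi3.integral_fun_mul_eq_mul_integral hmG.aestronglyMeasurable hmψ.aestronglyMeasurable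

lemma past_integrable (hmeasX : ∀ i, Measurable (X i)) (hmeasB : ∀ i, Measurable (B i))
    {N : ℕ} {G : (ℕ → ℤ) → ℝ} (hG : Past N G) (hb : ∃ C, ∀ x, |G x| ≤ C)
    (ψ : ℤ → ℤ → ℝ) (hψ : ∀ a b, |ψ a b| ≤ 1) (m : ℕ) :
    Integrable (fun ω => G (fun i => X i ω) * ψ (X m ω) (B m ω)) μ := by
  obtain ⟨C, hC⟩ := hb
  have hmG := past_measurable hmeasX hmeasB hG
  have hmψ : Measurable (fun ω => ψ (X m ω) (B m ω)) :=
    (measurable_of_countable (fun z : ℤ × ℤ => ψ z.1 z.2)).comp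
      ((hmeasX m).prodMk (hmeasB m))
  refine Integrable.of_bound (hmG.mul hmψ).aestronglyMeasurable C (ae_of_all _ fun ω => ?_)
  rw [Real.norm_eq_abs, abs_mul]
  have h1 := hC (fun i => X i ω)
  have h2 := hψ (X m ω) (B m ω)
  have := abs_nonneg (G (fun i => X i ω))
  have := abs_nonneg (ψ (X m ω) (B m ω))
  nlinarith

lemma past_integrable' (hmeasX : ∀ i, Measurable (X i)) (hmeasB : ∀ i, Measurable (B i))
    {N : ℕ} {G : (ℕ → ℤ) → ℝ} (hG : Past N G) (hb : ∃ C, ∀ x, |G x| ≤ C) :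
    Integrable (fun ω => G (fun i => X i ω)) μ := by
  simpa using past_integrable (μ := μ) hmeasX hmeasB hG hb (fun _ _ => 1) (by simp) 0

lemma integral_ind (hmeasX : ∀ i, Measurable (X i)) (i : ℕ) (a : ℤ) (c : ℝ) (hc : 0 ≤ c)
    (h : μ {ω | X i ω = a} = ENNReal.ofReal c) :
    ∫ ω, (if X i ω = a then (1 : ℝ) else 0) ∂μ = c := by
  have hms : MeasurableSet {ω | X i ω = a} := hmeasX i (measurableSet_singleton a)
  have : (fun ω => if X i ω = a then (1 : ℝ) else 0) = Set.indicator {ω | X i ω = a} 1 := by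
    ext ω
    simp [Set.indicator_apply]
  rw [this, integral_indicator_one hms, Measure.real, h, ENNReal.toReal_ofReal hc]

lemma integral_ind2 (hmeasX : ∀ i, Measurable (X i)) (hmeasB : ∀ i, Measurable (B i))
    (hindep : iIndepFun (Sum.elim X B) μ) (u v : ℕ ⊕ ℕ) (huv : u ≠ v) (a b : ℤ) :
    ∫ ω, (if Sum.elim X B u ω = a then (1 : ℝ) else 0) *
        (if Sum.elim X B v ω = b then 1 else 0) ∂μ =
      (∫ ω, (if Sum.elim X B u ω = a then (1 : ℝ) else 0) ∂μ) *
      ∫ ω, (if Sum.elim X B v ω = b then (1 : ℝ) else 0) ∂μ := by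
  have hm : ∀ i, Measurable (Sum.elim X B i) := by
    rintro (i | i)
    · exact hmeasX i
    · exact hmeasB i
  have hi := (hindep.indepFun huv).comp
    (measurable_of_countable (fun z : ℤ => if z = a then (1 : ℝ) else 0))
    (measurable_of_countable (fun z : ℤ => if z = b then (1 : ℝ) else 0))
  exact hi.integral_fun_mul_eq_mul_integral
    ((measurable_of_countable _).comp (hm u)).aestronglyMeasurable
    ((measurable_of_countable _).comp (hm v)).aestronglyMeasurable

lemma ae_two (hmeasX : ∀ i, Measurable (X i)) (i : ℕ) (a b : ℤ) (hab : a ≠ b) (c : ℝ)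
    (hc : 0 ≤ c) (hc1 : c ≤ 1)
    (h : μ {ω | X i ω = a} = ENNReal.ofReal c)
    (h' : μ {ω | X i ω = b} = ENNReal.ofReal (1 - c)) :
    ∀ᵐ ω ∂μ, X i ω = a ∨ X i ω = b := by
  have hms : ∀ a, MeasurableSet {ω | X i ω = a} := fun a => hmeasX i (measurableSet_singleton a)
  have hU : μ ({ω | X i ω = a} ∪ {ω | X i ω = b}) = 1 := by
    rw [measure_union _ (hms b), h, h', ← ENNReal.ofReal_add hc (by linarith)]
    · simp
    · rw [Set.disjoint_left]
      intro ω h1 h2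
      exact hab (h1.symm.trans h2)
  have := (prob_compl_eq_zero_iff ((hms a).union (hms b))).2 hU
  exact this

end Prob

theorem stmt14 {Ω : Type*} [MeasureSpace Ω] [IsProbabilityMeasure (ℙ : Measure Ω)]
    (q p γ : ℝ) (hq : 0 < q) (hq1 : q < 1 / 2) (hp : p = 1 - q)
    (hγ0 : 0 ≤ γ) (hγ1 : γ ≤ 1)
    (X B : ℕ → Ω → ℤ)
    (hmeasX : ∀ i, Measurable (X i)) (hmeasB : ∀ i, Measurable (B i))
    (hindep : iIndepFun (Sum.elim X B) ℙ)
    (hup : ∀ i, ℙ {ω | X i ω = 1} = ENNReal.ofReal q)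
    (hdown : ∀ i, ℙ {ω | X i ω = -1} = ENNReal.ofReal p)
    (hB1 : ∀ i, ℙ {ω | B i ω = 1} = ENNReal.ofReal γ)
    (hB0 : ∀ i, ℙ {ω | B i ω = 0} = ENNReal.ofReal (1 - γ))
    (n₁ : ℕ) (hn₁ : 2 ≤ n₁) :
    ∫ ω, (unclesU X B n₁ ω : ℝ) ∂(ℙ : Measure Ω)
      = q + q ^ 3 * γ / (p - q) - p ^ 3 / (p - q) * (q / p) ^ (n₁ + 1) * γ
        - q ^ (n₁ + 1) * (1 - γ) := by
  have hp0 : 0 < p := by linarith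
  have hpq : 0 < p - q := by linarith
  let ev : Ω → ℕ → ℤ := fun ω i => X i ω
  have iup : ∀ i, ∫ ω, (if X i ω = 1 then (1 : ℝ) else 0) = q := fun i =>
    integral_ind hmeasX i 1 q hq.le (hup i)
  have idn : ∀ i, ∫ ω, (if X i ω = -1 then (1 : ℝ) else 0) = p := fun i =>
    integral_ind hmeasX i (-1) p hp0.le (hdown i)
  have iB : ∀ i, ∫ ω, (if B i ω = 1 then (1 : ℝ) else 0) = γ := fun i =>
    integral_ind hmeasB i 1 γ hγ0 (hB1 i)
  have idB : ∀ i, ∫ ω, (if X i ω = -1 then (1 : ℝ) else 0) * (if B i ω = 1 then 1 else 0)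
      = p * γ := fun i => by
    have := integral_ind2 hmeasX hmeasB hindep (Sum.inl i) (Sum.inr i) (by simp) (-1) 1
    exact this.trans (congrArg₂ (· * ·) (idn i) (iB i))
  -- integrability of all functionals
  have int0 : ∀ n g, Integrable (fun ω => onAlive n g (fun i => X i ω)) (ℙ : Measure Ω) :=
    fun n g => past_integrable' hmeasX hmeasB (onAlive_past n g) (onAlive_bdd n g)
  have intU : ∀ n g, Integrable (fun ω => onAlive n g (fun i => X i ω) *
      (if X (n + 3) ω = 1 then 1 else 0)) (ℙ : Measure Ω) :=
    fun n g => past_integrable hmeasX hmeasB (onAlive_past n g) (onAlive_bdd n g)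
      (fun a _ => if a = 1 then 1 else 0) (fun a _ => by split_ifs <;> simp) (n + 3)
  have intD : ∀ n g, Integrable (fun ω => onAlive n g (fun i => X i ω) *
      (if X (n + 3) ω = -1 then 1 else 0)) (ℙ : Measure Ω) :=
    fun n g => past_integrable hmeasX hmeasB (onAlive_past n g) (onAlive_bdd n g)
      (fun a _ => if a = -1 then 1 else 0) (fun a _ => by split_ifs <;> simp) (n + 3)
  have intB : ∀ n g, Integrable (fun ω => onAlive n g (fun i => X i ω) *
      ((if X (n + 3) ω = -1 then 1 else 0) * (if B (n + 3) ω = 1 then 1 else 0)))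
      (ℙ : Measure Ω) :=
    fun n g => past_integrable hmeasX hmeasB (onAlive_past n g) (onAlive_bdd n g)
      (fun a b => (if a = -1 then 1 else 0) * (if b = 1 then 1 else 0))
      (fun a b => by split_ifs <;> simp) (n + 3)
  have eU : ∀ n g, ∫ ω, onAlive n g (fun i => X i ω) * (if X (n + 3) ω = 1 then 1 else 0)
      = (∫ ω, onAlive n g (fun i => X i ω)) * q := fun n g => by
    rw [← iup (n + 3)]
    exact past_integral hmeasX hmeasB hindep (onAlive_past n g) (fun a _ => if a = 1 then 1 else 0)
  have eD : ∀ n g, ∫ ω, onAlive n g (fun i => X i ω) * (if X (n + 3) ω = -1 then 1 else 0)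
      = (∫ ω, onAlive n g (fun i => X i ω)) * p := fun n g => by
    rw [← idn (n + 3)]
    exact past_integral hmeasX hmeasB hindep (onAlive_past n g) (fun a _ => if a = -1 then 1 else 0)
  have eB : ∀ n g, ∫ ω, onAlive n g (fun i => X i ω) *
      ((if X (n + 3) ω = -1 then 1 else 0) * (if B (n + 3) ω = 1 then 1 else 0))
      = (∫ ω, onAlive n g (fun i => X i ω)) * (p * γ) := fun n g => by
    rw [← idB (n + 3)]
    exact past_integral hmeasX hmeasB hindep (onAlive_past n g)
      (fun a b => (if a = -1 then 1 else 0) * (if b = 1 then 1 else 0))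
  have eSucc : ∀ n g, ∫ ω, onAlive (n + 1) g (fun i => X i ω) =
      (∫ ω, onAlive n (fun s => g (s + 1)) (fun i => X i ω)) * q +
      (∫ ω, onAlive n (fun s => if 3 ≤ s then g (s - 1) else 0) (fun i => X i ω)) * p :=
    fun n g => by
    simp_rw [onAlive_succ n g]
    rw [integral_add (intU _ _) (intD _ _), eU, eD]
  -- probability of being alive
  let a : ℕ → ℝ := fun n => ∫ ω, onAlive n (fun _ => 1) (fun i => X i ω)
  let t : ℕ → ℝ := fun n => ∫ ω, onAlive n (fun s => (s : ℝ) - 1) (fun i => X i ω)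
  have ha0 : ∀ n, 0 ≤ a n := fun n => integral_nonneg fun ω =>
    onAlive_nonneg n _ (fun _ => zero_le_one) _
  have ht0 : ∀ n, 0 ≤ t n := fun n => integral_nonneg fun ω => by
    unfold onAlive
    dsimp only
    split_ifs with h
    · have := h.bounds.1
      have : (2 : ℝ) ≤ (sx (fun i => X i ω) (n + 2) : ℝ) := by exact_mod_cast this
      simp only [Pi.zero_apply]
      linarith
    · exact le_rfl
  have ht : ∀ n, t (n + 1) = t n - (p - q) * a n := by
    intro n
    show ∫ ω, onAlive (n + 1) _ _ = _
    rw [eSucc, ← integral_mul_const, ← integral_mul_const,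
      ← integral_add ((int0 _ _).mul_const _) ((int0 _ _).mul_const _),
      ← integral_const_mul, ← integral_sub (int0 _ _) ((int0 _ _).const_mul _)]
    congr 1
    ext ω
    unfold onAlive
    by_cases h : Alive (fun i => X i ω) n
    · simp only [h, if_true]
      by_cases h3 : 3 ≤ sx (fun i => X i ω) (n + 2)
      · rw [if_pos h3]
        push_cast
        rw [hp]; ring
      · rw [if_neg h3]
        have : sx (fun i => X i ω) (n + 2) = 2 := by
          have := h.bounds.1
          omega
        rw [this]
        push_cast
        rw [hp]; ring
    · simp [h]
  have hsum_a : Summable a := by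
    refine summable_of_sum_range_le (c := t 0 / (p - q)) ha0 fun N => ?_
    have : ∀ N, (p - q) * ∑ i ∈ Finset.range N, a i = t 0 - t N := by
      intro N
      induction N with
      | zero => simp
      | succ N ih => rw [Finset.sum_range_succ, mul_add, ih, ht]; ring
    rw [le_div_iff₀ hpq, mul_comm, this]
    linarith [ht0 N]
  have ha_lim := hsum_a.tendsto_atTop_zero
  -- the cycle is almost surely finite
  have hfin : ∀ᵐ ω ∂(ℙ : Measure Ω), ∃ n, ¬ Alive (fun i => X i ω) n := by
    classical
    have hmsA : ∀ n, MeasurableSet {ω | Alive (fun i => X i ω) n} := by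
      intro n
      have hm := past_measurable hmeasX hmeasB (onAlive_past n (fun _ => 1))
      have := hm (measurableSet_singleton (1 : ℝ))
      convert this using 1
      ext ω
      simp [onAlive]
    have hreal : ∀ n, (ℙ : Measure Ω).real {ω | Alive (fun i => X i ω) n} = a n := by
      intro n
      rw [← integral_indicator_one (hmsA n)]
      refine integral_congr_ae (ae_of_all _ fun ω => ?_)
      simp [onAlive, Set.indicator_apply]
    rw [ae_iff]
    push Not
    have hle : ∀ n, (ℙ : Measure Ω).real {ω | ∀ n, Alive (fun i => X i ω) n} ≤ a n := by
      intro n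
      rw [← hreal n]
      exact measureReal_mono (fun ω h => h n)
    have h0 : (ℙ : Measure Ω).real {ω | ∀ n, Alive (fun i => X i ω) n} = 0 :=
      le_antisymm (ge_of_tendsto' ha_lim hle) measureReal_nonneg
    exact (measureReal_eq_zero_iff).1 h0
  -- value process
  let v : ℕ → ℝ := fun n => ∫ ω, onAlive n (vv q p γ n₁ n) (fun i => X i ω)
  let R : ℕ → Ω → ℝ := fun n ω => rew n₁ n (fun i => X i ω) (fun i => B i ω)
  have hRint : ∀ n, Integrable (R n) (ℙ : Measure Ω) := fun n => (intB n _).add (intD n _)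
  have hstep : ∀ n, ∫ ω, R n ω = v n - v (n + 1) := by
    intro n
    have e1 : ∫ ω, R n ω = _ := integral_add (intB n _) (intD n _)
    have e2 : v (n + 1) = _ := eSucc n _
    rw [eB, eD] at e1
    rw [e1, e2, eq_sub_iff_add_eq]
    simp_rw [← integral_mul_const]
    rw [← integral_add ((int0 _ _).mul_const _) ((int0 _ _).mul_const _),
      ← integral_add ((int0 _ _).mul_const _) ((int0 _ _).mul_const _)]
    refine (integral_add (((int0 _ _).mul_const _).add ((int0 _ _).mul_const _))
        (((int0 _ _).mul_const _).add ((int0 _ _).mul_const _))).symm.trans ?_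
    congr 1
    ext ω
    unfold onAlive
    by_cases h : Alive (fun i => X i ω) n
    · simp only [Pi.add_apply, h, if_true]
      rw [← vv_step q p γ hp0 hp n₁ n _ h.bounds.1 h.bounds.2]
      ring
    · simp [h]
  have hr : 0 ≤ q / p := by positivity
  have hww : ∀ N, 0 ≤ ww q n₁ N ∧ ww q n₁ N ≤ 1 := fun N => by
    unfold ww
    have h1 : q ^ (n₁ + 1 - N) ≤ 1 := pow_le_one₀ hq.le (by linarith)
    have h2 : 0 ≤ q ^ (n₁ + 1 - N) := by positivity
    constructor <;> linarith
  have hvv0 : ∀ n s, 0 ≤ vv q p γ n₁ n s := fun n s => by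
    unfold vv
    have h1 := HH_nonneg hr n₁ (s - 1).toNat
    have h2 : 0 ≤ (if s = n + 2 then ww q n₁ (n + 2) else 0) := by
      split_ifs
      · exact (hww _).1
      · exact le_rfl
    have : 0 ≤ 1 - γ := by linarith
    positivity
  have hvv1 : ∀ n s, vv q p γ n₁ n s ≤ HH (q / p) n₁ n₁ + 1 := fun n s => by
    unfold vv
    have h0 := HH_nonneg hr n₁ (s - 1).toNat
    have h1 := HH_le hr n₁ (s - 1).toNat
    have h2 : 0 ≤ (if s = n + 2 then ww q n₁ (n + 2) else 0) := by
      split_ifs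
      · exact (hww _).1
      · exact le_rfl
    have h3 : (if s = n + 2 then ww q n₁ (n + 2) else 0) ≤ 1 := by
      split_ifs
      · exact (hww _).2
      · exact zero_le_one
    nlinarith
  have hv0 : ∀ n, 0 ≤ v n := fun n => integral_nonneg fun ω =>
    onAlive_nonneg n _ (hvv0 n) _
  have hv1 : ∀ n, v n ≤ (HH (q / p) n₁ n₁ + 1) * a n := fun n => by
    rw [← integral_const_mul]
    refine integral_mono (int0 _ _) ((int0 _ _).const_mul _) fun ω => ?_
    simp only [onAlive]
    split_ifs
    · simpa using hvv1 n _
    · simp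
  have hv_lim : Tendsto v atTop (nhds 0) := by
    refine squeeze_zero hv0 hv1 ?_
    simpa using ha_lim.const_mul (HH (q / p) n₁ n₁ + 1)
  have hpart : ∀ N, ∑ i ∈ Finset.range N, ∫ ω, R i ω = v 0 - v N := by
    intro N
    simp_rw [hstep]
    exact Finset.sum_range_sub' v N
  have hRpos : ∀ n ω, 0 ≤ R n ω := fun n ω => rew_nonneg _ _ _ _
  have hnorm : ∀ n, ∫ ω, ‖R n ω‖ = ∫ ω, R n ω := fun n => by
    simp_rw [Real.norm_of_nonneg (hRpos n _)]
  have hsumR : Summable fun n => ∫ ω, R n ω :=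
    summable_of_sum_range_le (c := v 0) (fun n => integral_nonneg (hRpos n)) fun N => by
      rw [hpart]; linarith [hv0 N]
  have hHS := hasSum_integral_of_summable_integral_norm hRint (by simpa only [hnorm] using hsumR)
  have htot : ∫ ω, ∑' n, R n ω = v 0 := by
    refine tendsto_nhds_unique hHS.tendsto_sum_nat ?_
    simp_rw [hpart]
    simpa using hv_lim.const_sub (v 0)
  have h12 : ∀ c : ℤ, ∫ ω, (if X 1 ω = 1 then (1 : ℝ) else 0) * (if X 2 ω = c then 1 else 0)
      = q * ∫ ω, (if X 2 ω = c then (1 : ℝ) else 0) := fun c => by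
    have := integral_ind2 hmeasX hmeasB hindep (Sum.inl 1) (Sum.inl 2) (by simp) 1 c
    exact this.trans (congrArg (· * _) (iup 1))
  have hv00 : v 0 = q * q * vv q p γ n₁ 0 2 := by
    have h := h12 1
    rw [iup] at h
    rw [← h, ← integral_mul_const]
    refine integral_congr_ae (ae_of_all _ fun ω => ?_)
    dsimp only
    unfold onAlive
    by_cases h1 : X 1 ω = 1 <;> by_cases h2 : X 2 ω = 1 <;> simp [Alive, h1, h2, sx_two]
  have hpos : 0 < vv q p γ n₁ 0 2 := by
    have e : vv q p γ n₁ 0 2 = γ * HH (q / p) n₁ 1 + (1 - γ) * ww q n₁ 2 := by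
      norm_num [vv]
    have h1 : 0 < HH (q / p) n₁ 1 := by
      simp only [HH, Finset.sum_range_one, dd, Nat.sub_zero]
      exact Finset.sum_pos (fun _ _ => by positivity) ⟨0, by simp; omega⟩
    have h2 : 0 < ww q n₁ 2 := by
      have := pow_lt_one₀ hq.le (by linarith) (show n₁ + 1 - 2 ≠ 0 by omega)
      unfold ww
      linarith
    rw [e]
    rcases hγ0.eq_or_lt with h | h
    · rw [← h]; linarith
    · have := mul_pos h h1
      have : 0 ≤ (1 - γ) * ww q n₁ 2 := mul_nonneg (by linarith) h2.le
      linarith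
  have htotint : Integrable (fun ω => ∑' n, R n ω) (ℙ : Measure Ω) := by
    by_contra hcon
    have := integral_undef hcon
    rw [htot, hv00] at this
    have : 0 < q * q * vv q p γ n₁ 0 2 := by positivity
    linarith
  have hXae : ∀ᵐ ω ∂(ℙ : Measure Ω), ∀ i, X i ω = 1 ∨ X i ω = -1 :=
    ae_all_iff.2 fun i => ae_two hmeasX i 1 (-1) (by decide) q hq.le (by linarith) (hup i)
      (hp ▸ hdown i)
  have hBae : ∀ᵐ ω ∂(ℙ : Measure Ω), ∀ i, B i ω = 1 ∨ B i ω = 0 :=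
    ae_all_iff.2 fun i => ae_two hmeasB i 1 0 (by decide) γ hγ0 hγ1 (hB1 i) (hB0 i)
  have hU : ∫ ω, (unclesU X B n₁ ω : ℝ) = q * p + v 0 := by
    rw [← htot, ← idn 2, ← h12, ← integral_add _ htotint]
    · apply integral_congr_ae
      filter_upwards [hXae, hBae, hfin] with ω h1 h2 h3
      exact path_identity X B n₁ ω h1 h2 h3
    · by_contra hcon
      have := integral_undef hcon
      rw [h12, idn] at this
      have : 0 < q * p := by positivity
      linarith
  rw [hU, hv00]
  have hH : HH (q / p) n₁ 1 = ((q / p) ^ (n₁ - 1) - 1) / (q / p - 1) := by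
    simp only [HH, Finset.sum_range_one, dd, Nat.sub_zero]
    exact geom_sum_eq (by rw [ne_eq, div_eq_one_iff_eq hp0.ne']; linarith) _
  obtain ⟨m, rfl⟩ : ∃ m, n₁ = m + 1 := ⟨n₁ - 1, by omega⟩
  have hne : q / p - 1 = -((p - q) / p) := by field_simp; ring
  simp only [vv, ww]
  norm_num
  rw [hH, hne]
  simp only [Nat.add_sub_cancel]
  rw [show m + 1 + 1 = m + 2 from rfl, show m + 2 - 2 = m from rfl, pow_add (q / p), pow_add q m 2]
  have hpq' := hpq.ne'
  generalize q ^ m = z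
  generalize (q / p) ^ m = y
  have : q = 1 - p := by linarith
  field_simp
  rw [hp]
  ring
end

section
/- Let n₁ ≥ 2 be an integer and 0 < q < 1. The probability that the attack cycle has the form S^k H^{k−1} for some k with 2 ≤ k ≤ n₁ — that is, for some such k, X_i = +1 for 1 ≤ i ≤ k and X_i = −1 for k + 1 ≤ i ≤ 2k − 1 — equals p q² (1 − (pq)^{n₁−1})/(1 − pq). (In Strategy 2A this is E[V], the expected number of uncles of a cycle referred only in a later attack cycle.) -/
open MeasureTheory ProbabilityTheory Filter Finset

theorem stmt19 {Ω : Type*} [MeasureSpace Ω] [IsProbabilityMeasure (ℙ : Measure Ω)]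
    (q p : ℝ) (hq : 0 < q) (hq1 : q < 1) (hp : p = 1 - q)
    (X : ℕ → Ω → ℤ) (hmeas : ∀ i, Measurable (X i))
    (hindep : iIndepFun X ℙ)
    (hup : ∀ i, ℙ {ω | X i ω = 1} = ENNReal.ofReal q)
    (hdown : ∀ i, ℙ {ω | X i ω = -1} = ENNReal.ofReal p)
    (n₁ : ℕ) (hn₁ : 2 ≤ n₁) :
    ℙ {ω | ∃ k : ℕ, 2 ≤ k ∧ k ≤ n₁ ∧
        (∀ i ∈ Finset.Icc 1 k, X i ω = 1) ∧
        (∀ i ∈ Finset.Icc (k + 1) (2 * k - 1), X i ω = -1)}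
      = ENNReal.ofReal (p * q ^ 2 * (1 - (p * q) ^ (n₁ - 1)) / (1 - p * q)) := by
  have hp0 : 0 < p := by linarith
  have hset : {ω | ∃ k : ℕ, 2 ≤ k ∧ k ≤ n₁ ∧
        (∀ i ∈ Finset.Icc 1 k, X i ω = 1) ∧
        (∀ i ∈ Finset.Icc (k + 1) (2 * k - 1), X i ω = -1)}
      = ⋃ k ∈ Finset.Icc 2 n₁, ⋂ i ∈ Finset.Icc 1 (2 * k - 1),
          X i ⁻¹' {if i ≤ k then (1 : ℤ) else -1} := by
    ext ω
    simp only [Set.mem_ofPred_eq, Set.mem_iUnion, Set.mem_iInter, Finset.mem_Icc,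
      Set.mem_preimage, Set.mem_singleton_iff, exists_prop]
    constructor
    · rintro ⟨k, h2, hk, h1, h3⟩
      refine ⟨k, ⟨h2, hk⟩, fun i hi => ?_⟩
      split_ifs with h
      · exact h1 i ⟨hi.1, h⟩
      · exact h3 i ⟨by omega, hi.2⟩
    · rintro ⟨k, ⟨h2, hk⟩, h⟩
      refine ⟨k, h2, hk, fun i hi => ?_, fun i hi => ?_⟩
      · have := h i ⟨hi.1, by omega⟩
        rwa [if_pos hi.2] at this
      · have := h i ⟨by omega, hi.2⟩
        rwa [if_neg (by omega)] at this
  have hE : ∀ k ∈ Finset.Icc 2 n₁, ℙ (⋂ i ∈ Finset.Icc 1 (2 * k - 1),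
          X i ⁻¹' {if i ≤ k then (1 : ℤ) else -1}) = ENNReal.ofReal (q ^ k * p ^ (k - 1)) := by
    intro k hk
    rw [Finset.mem_Icc] at hk
    rw [hindep.measure_inter_preimage_eq_mul (Finset.Icc 1 (2 * k - 1))
      (sets := fun i => {if i ≤ k then (1 : ℤ) else -1}) (fun i _ => MeasurableSet.singleton _)]
    have h1 : ∀ i ∈ Finset.Icc 1 (2 * k - 1), ℙ (X i ⁻¹' {if i ≤ k then (1 : ℤ) else -1})
        = if i ≤ k then ENNReal.ofReal q else ENNReal.ofReal p := by
      intro i _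
      split_ifs
      · exact hup i
      · exact hdown i
    rw [Finset.prod_congr rfl h1, Finset.prod_ite, Finset.prod_const, Finset.prod_const]
    have e1 : (Finset.Icc 1 (2 * k - 1)).filter (fun i => i ≤ k) = Finset.Icc 1 k := by
      ext i
      simp only [Finset.mem_filter, Finset.mem_Icc]
      omega
    have e2 : (Finset.Icc 1 (2 * k - 1)).filter (fun i => ¬ i ≤ k)
        = Finset.Icc (k + 1) (2 * k - 1) := by
      ext i
      simp only [Finset.mem_filter, Finset.mem_Icc]
      omega
    rw [e1, e2, Nat.card_Icc, Nat.card_Icc, ENNReal.ofReal_mul (by positivity),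
      ENNReal.ofReal_pow hq.le, ENNReal.ofReal_pow hp0.le]
    congr 2
    omega
  have hlt : ∀ k l : ℕ, 2 ≤ k → k < l → Disjoint
      (⋂ i ∈ Finset.Icc 1 (2 * k - 1), X i ⁻¹' {if i ≤ k then (1 : ℤ) else -1})
      (⋂ i ∈ Finset.Icc 1 (2 * l - 1), X i ⁻¹' {if i ≤ l then (1 : ℤ) else -1}) := by
    intro k l hk hl
    rw [Set.disjoint_left]
    intro ω ha hb
    simp only [Set.mem_iInter, Finset.mem_Icc, Set.mem_preimage, Set.mem_singleton_iff] at ha hb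
    have a := ha (k + 1) ⟨by omega, by omega⟩
    have b := hb (k + 1) ⟨by omega, by omega⟩
    rw [if_neg (by omega)] at a
    rw [if_pos (by omega)] at b
    omega
  rw [hset, measure_biUnion_finset, Finset.sum_congr rfl hE,
    ← ENNReal.ofReal_sum_of_nonneg (fun k _ => by positivity)]
  · congr 1
    have hne : 1 - p * q ≠ 0 := by nlinarith
    rw [eq_div_iff hne]
    clear hE hset hlt
    induction n₁, hn₁ using Nat.le_induction with
    | base => simp [mul_comm]
    | succ n hn ih =>
      rw [Finset.sum_Icc_succ_top (by omega), add_mul, ih]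
      obtain ⟨m, rfl⟩ : ∃ m, n = m + 1 := ⟨n - 1, by omega⟩
      simp only [Nat.add_sub_cancel, mul_pow]
      ring
  · intro k hk l hl hkl
    simp only [Finset.coe_Icc, Set.mem_Icc] at hk hl
    rcases lt_or_gt_of_ne hkl with h | h
    · exact hlt k l hk.1 h
    · exact (hlt l k hl.1 h).symm
  · intro k _
    exact Finset.measurableSet_biInter _ fun i _ => hmeas i (MeasurableSet.singleton _)
end
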